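/- Let J < 0, I₀ > 0, and p ∈ (0,1] be real numbers, and define the scalar mean-field map f : ℝ → ℝ by f(m) = (1-p)·m + p·tanh(I₀·J·m). If (1-p) + p·I₀·J < -1, then there exists m* > 0 such that f(m*) = -m* and f(-m*) = m*; that is, the pair {m*, -m*} is a genuine period-2 orbit of f. -/

import Mathlib

theorem hasDerivAt_real_tanh_zero : HasDerivAt Real.tanh 1 0 := by
  have h := (Real.hasDerivAt_sinh 0).div (Real.hasDerivAt_cosh 0) (Real.cosh_pos 0).ne'
  have heq : Real.tanh = Real.sinh / Real.cosh := funext Real.tanh_eq_sinh_div_cosh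
  rw [heq]
  simpa using h

theorem continuous_real_tanh : Continuous Real.tanh := by
  have heq : Real.tanh = fun x => Real.sinh x / Real.cosh x := funext Real.tanh_eq_sinh_div_cosh
  rw [heq]
  exact Real.continuous_sinh.div Real.continuous_cosh fun x => (Real.cosh_pos x).ne'

theorem HasDerivAt.exists_pos_lt_one_neg_of_deriv_neg {g : ℝ → ℝ} {d : ℝ}
    (hg : HasDerivAt g d 0) (h0 : g 0 = 0) (hd : d < 0) :
    ∃ x, 0 < x ∧ x < 1 ∧ g x < 0 := by
  have hslope := hg.tendsto_slope_zero_right.eventually (gt_mem_nhds hd)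
  have hmem : ∀ᶠ x : ℝ in nhdsWithin 0 (Set.Ioi 0), x ∈ Set.Ioo 0 1 :=
    Ioo_mem_nhdsGT one_pos
  obtain ⟨x, hx, hx0, hx1⟩ := (hslope.and hmem).exists
  refine ⟨x, hx0, hx1, ?_⟩
  simp only [zero_add, h0, sub_zero, smul_eq_mul] at hx
  exact (pos_iff_neg_of_mul_neg hx).mp (inv_pos.mpr hx0)

/-- For the scalar mean-field map
`f(m) = (1-p)·m + p·tanh(I₀·J·m)` with `J < 0`, `I₀ > 0`, `p ∈ (0,1]`,
if `(1-p) + p·I₀·J < -1` (linear instability of the period-2 mode), then there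
is `m* > 0` with `f(m*) = -m*` and `f(-m*) = m*`, i.e. `{m*, -m*}` is a genuine
period-2 orbit of `f`. -/
theorem scalar_meanfield_period2_orbit (J I0 p : ℝ)
    (hJ : J < 0) (hI0 : 0 < I0) (hp0 : 0 < p) (hp1 : p ≤ 1)
    (hunst : (1 - p) + p * I0 * J < -1) :
    ∃ m : ℝ, 0 < m ∧
      (1 - p) * m + p * Real.tanh (I0 * J * m) = -m ∧
      (1 - p) * (-m) + p * Real.tanh (I0 * J * (-m)) = m := by
  set g : ℝ → ℝ := fun m => (2 - p) * m + p * Real.tanh (I0 * J * m) with hg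
  have hderiv : HasDerivAt g (2 - p + p * I0 * J) 0 := by
    have hlin : HasDerivAt (fun m : ℝ => I0 * J * m) (I0 * J) 0 := by
      simpa using (hasDerivAt_id (0 : ℝ)).const_mul (I0 * J)
    have htanh : HasDerivAt (fun m : ℝ => Real.tanh (I0 * J * m)) (1 * (I0 * J)) 0 :=
      HasDerivAt.comp (h₂ := Real.tanh) 0 (by simpa using hasDerivAt_real_tanh_zero) hlin
    exact (((hasDerivAt_id (0 : ℝ)).const_mul (2 - p)).add (htanh.const_mul p)).congr_deriv
      (by ring)
  have hcont : Continuous g :=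
    (continuous_const.mul continuous_id).add
      (continuous_const.mul (continuous_real_tanh.comp (continuous_const.mul continuous_id)))
  obtain ⟨x, hx0, hx1, hgx⟩ :=
    hderiv.exists_pos_lt_one_neg_of_deriv_neg (by simp [hg]) (by linarith)
  have hg1 : 0 ≤ g 1 := by
    have := Real.neg_one_lt_tanh (I0 * J * 1)
    simp only [hg]
    nlinarith
  obtain ⟨m, hm, hgm⟩ := intermediate_value_Icc hx1.le hcont.continuousOn ⟨hgx.le, hg1⟩
  simp only [hg] at hgm
  refine ⟨m, hx0.trans_le hm.1, by linarith, ?_⟩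
  rw [mul_neg (I0 * J), Real.tanh_neg]
  linarith
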